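/- arXiv:1602.00748 — 5 statements merged into one kernel-verified Lean document; each statement's English description precedes it below -/
import Mathlib

section
/- Let E be a Gysin functor on a finitary lextensive category C. Then the data of the category of correspondences C_E is a category enriched over abelian groups: the composition β ∘ α := (π_{CA})_!((π_{CB})^*(β) · (π_{BA})^*(α)) is bilinear and associative, and i_A := Δ_!(1) is a two-sided identity for every object A. Moreover: (i) the assignment which is the identity on objects and sends f to Rf is a functor R : C → C_E; (ii) the assignment α ↦ α^* := t^*(α), where t : A × B → B × A is the transposition isomorphism, is an anti-automorphism of C_E that is the identity on objects (so (g ∘ f)^* = f^* ∘ g^* and (i_A)^* = i_A); and (iii) If = (Rf)^* for every morphism f of C. -/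
open CategoryTheory CategoryTheory.Limits

universe v u

/-- A Gysin functor on a finitary lextensive category `C`. -/
structure GysinFunctor (C : Type u) [Category.{v} C] [HasFiniteLimits C]
    [HasFiniteCoproducts C] [FinitaryExtensive C] where
  /-- The underlying rings. -/
  E : C → Type v
  commRing : ∀ X : C, CommRing (E X)
  /-- Contravariant functoriality (pullback), by ring maps. -/
  pull : ∀ {X Y : C}, (X ⟶ Y) → (E Y →+* E X)
  pull_id : ∀ X : C, pull (𝟙 X) = RingHom.id (E X)
  pull_comp : ∀ {X Y Z : C} (f : X ⟶ Y) (g : Y ⟶ Z),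
    pull (f ≫ g) = (pull f).comp (pull g)
  /-- Covariant functoriality (pushforward/Gysin maps), by additive maps. -/
  push : ∀ {X Y : C}, (X ⟶ Y) → (E X →+ E Y)
  push_id : ∀ X : C, push (𝟙 X) = AddMonoidHom.id (E X)
  push_comp : ∀ {X Y Z : C} (f : X ⟶ Y) (g : Y ⟶ Z),
    push (f ≫ g) = (push g).comp (push f)
  /-- Zero axiom: `E ∅ = 0`. -/
  zero : Subsingleton (E (⊥_ C))
  /-- Behavior on sums. -/
  coprod_bij : ∀ X Y : C, Function.Bijective
    (fun a : E (X ⨿ Y) => (pull coprod.inl a, pull coprod.inr a))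
  /-- Push-product axiom. -/
  push_product : ∀ {X X' Y Y' : C} (f : X ⟶ X') (g : Y ⟶ Y') (a : E X) (b : E Y),
    push (prod.map f g) (pull prod.fst a * pull prod.snd b)
      = pull prod.fst (push f a) * pull prod.snd (push g b)
  /-- Push-pull axiom. -/
  push_pull : ∀ {A B C' D' : C} (f : A ⟶ B) (p : A ⟶ C') (q : B ⟶ D') (g : C' ⟶ D'),
    IsPullback f p q g → ∀ a : E C', push f (pull p a) = pull q (push g a)

namespace GysinFunctor

attribute [instance] GysinFunctor.commRing

variable {C : Type u} [Category.{v} C] [HasFiniteLimits C]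
  [HasFiniteCoproducts C] [FinitaryExtensive C] (G : GysinFunctor C)

/-- Hom-groups of the category of correspondences: `C_E(A, B) = E(B × A)`. -/
noncomputable def Hom (A B : C) : Type v := G.E (B ⨯ A)

noncomputable instance (A B : C) : AddCommGroup (G.Hom A B) :=
  inferInstanceAs (AddCommGroup (G.E (B ⨯ A)))

/-- Composition in the category of correspondences. -/
noncomputable def comp {A B Cc : C} (β : G.Hom B Cc) (α : G.Hom A B) : G.Hom A Cc :=
  G.push (prod.map prod.fst (𝟙 A) : (Cc ⨯ B) ⨯ A ⟶ Cc ⨯ A)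
    (G.pull (prod.fst : (Cc ⨯ B) ⨯ A ⟶ Cc ⨯ B) β *
      G.pull (prod.map prod.snd (𝟙 A) : (Cc ⨯ B) ⨯ A ⟶ B ⨯ A) α)

/-- The identity morphism `i_A = Δ_!(1)` in the category of correspondences. -/
noncomputable def ident (A : C) : G.Hom A A := G.push (diag A) 1

/-- `Rf`, the forward map associated to `f : A ⟶ B`. -/
noncomputable def Rmor {A B : C} (f : A ⟶ B) : G.Hom A B :=
  G.push (prod.lift f (𝟙 A)) 1

/-- `If`, the transfer map associated to `f : A ⟶ B`. -/
noncomputable def Imor {A B : C} (f : A ⟶ B) : G.Hom B A :=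
  G.push (prod.lift (𝟙 A) f) 1

/-- `Da`, the diagonal endomorphism associated to `a ∈ E(A)`. -/
noncomputable def Dmor {A : C} (a : G.E A) : G.Hom A A := G.push (diag A) a

/-- The duality anti-automorphism on hom-groups. -/
noncomputable def star {A B : C} (α : G.Hom A B) : G.Hom B A :=
  G.pull (prod.braiding A B).hom α

end GysinFunctor

namespace GysinFunctor

attribute [local simp] prod.lift_fst prod.lift_snd prod.lift_fst_assoc prod.lift_snd_assoc

variable {C : Type u} [Category.{v} C]

/-- A commutative square with existence and uniqueness of fillers is a pullback. -/
theorem isPullback_of_exists_lift {P X Y Z : C} {f : P ⟶ X} {p : P ⟶ Y} {q : X ⟶ Z}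
    {g : Y ⟶ Z} (w : f ≫ q = p ≫ g)
    (hex : ∀ (T : C) (s : T ⟶ X) (t : T ⟶ Y), s ≫ q = t ≫ g →
      ∃ l : T ⟶ P, l ≫ f = s ∧ l ≫ p = t)
    (huniq : ∀ (T : C) (l l' : T ⟶ P), l ≫ f = l' ≫ f → l ≫ p = l' ≫ p → l = l') :
    IsPullback f p q g := by
  choose l hl using hex
  exact ⟨⟨w⟩, ⟨PullbackCone.IsLimit.mk w (fun s => l _ s.fst s.snd s.condition)
    (fun s => (hl _ s.fst s.snd s.condition).1) (fun s => (hl _ s.fst s.snd s.condition).2)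
    (fun s m h₁ h₂ => huniq _ _ _ (h₁.trans (hl _ s.fst s.snd s.condition).1.symm)
      (h₂.trans (hl _ s.fst s.snd s.condition).2.symm))⟩⟩

variable [HasFiniteLimits C] [HasFiniteCoproducts C] [FinitaryExtensive C]
  (G : GysinFunctor C)

theorem pull_pull {X Y Z : C} (f : X ⟶ Y) (g : Y ⟶ Z) (a : G.E Z) :
    G.pull f (G.pull g a) = G.pull (f ≫ g) a := by
  rw [G.pull_comp]; rfl

theorem push_push {X Y Z : C} (f : X ⟶ Y) (g : Y ⟶ Z) (a : G.E X) :
    G.push g (G.push f a) = G.push (f ≫ g) a := by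
  rw [G.push_comp]; rfl

theorem pull_id_apply {X : C} (a : G.E X) : G.pull (𝟙 X) a = a := by
  rw [G.pull_id]; rfl

theorem push_id_apply {X : C} (a : G.E X) : G.push (𝟙 X) a = a := by
  rw [G.push_id]; rfl

/-- The projection formula. -/
theorem push_mul_pull {X Y : C} (f : X ⟶ Y) (a : G.E X) (b : G.E Y) :
    G.push f (a * G.pull f b) = G.push f a * b := by
  have hp : IsPullback f (prod.lift (𝟙 X) f) (diag Y) (prod.map f (𝟙 Y)) := by
    refine isPullback_of_exists_lift (by ext <;> simp) (fun T s t h => ?_)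
      (fun T l l' _ h => by simpa using congr($h ≫ prod.fst))
    have h₁ : s = (t ≫ prod.fst) ≫ f := by simpa using congr($h ≫ prod.fst)
    have h₂ : s = t ≫ prod.snd := by simpa using congr($h ≫ prod.snd)
    exact ⟨t ≫ prod.fst, h₁.symm, by ext <;> simp [← h₂, h₁]⟩
  have h := G.push_pull _ _ _ _ hp (G.pull prod.fst a * G.pull prod.snd b)
  rw [G.push_product] at h
  simpa [pull_pull, push_id_apply, pull_id_apply] using h

theorem push_pull_mul {X Y : C} (f : X ⟶ Y) (a : G.E X) (b : G.E Y) :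
    G.push f (G.pull f b * a) = b * G.push f a := by
  rw [mul_comm, push_mul_pull, mul_comm]

theorem push_pull_of_isIso {X Y : C} (f : X ⟶ Y) [IsIso f] (a : G.E Y) :
    G.push f (G.pull f a) = a := by
  have h := G.push_pull f f (𝟙 Y) (𝟙 Y) (IsPullback.of_vert_isIso ⟨by simp⟩) a
  simpa [push_id_apply, pull_id_apply] using h

theorem pull_eq_push_inv {X Y : C} (e : X ≅ Y) (a : G.E Y) :
    G.pull e.hom a = G.push e.inv a := by
  have h := G.push_pull_of_isIso e.inv (G.pull e.hom a)
  rw [pull_pull] at h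
  simpa [pull_id_apply] using h.symm

/-- Composition of correspondences may be computed on any object isomorphic to the
triple product. -/
theorem comp_eq_push_of_iso {A B D T : C} (e : T ≅ (D ⨯ B) ⨯ A)
    (β : G.E (D ⨯ B)) (α : G.E (B ⨯ A)) :
    (G.comp (A := A) (B := B) (Cc := D) β α : G.E (D ⨯ A)) =
      G.push (e.hom ≫ prod.map prod.fst (𝟙 A))
        (G.pull (e.hom ≫ prod.fst) β * G.pull (e.hom ≫ prod.map prod.snd (𝟙 A)) α) := by
  rw [← pull_pull, ← pull_pull, ← map_mul, ← push_push, push_pull_of_isIso]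
  rfl

theorem comp_comp_right {A B D F : C} (γ : G.E (F ⨯ D)) (β : G.E (D ⨯ B))
    (α : G.E (B ⨯ A)) :
    (G.comp (A := A) (B := D) (Cc := F) γ (G.comp (A := A) (B := B) (Cc := D) β α) :
        G.E (F ⨯ A)) =
      G.push (prod.map (prod.fst ≫ prod.fst) (𝟙 A) : ((F ⨯ D) ⨯ B) ⨯ A ⟶ F ⨯ A)
        (G.pull (prod.fst ≫ prod.fst) γ *
          (G.pull (prod.fst ≫ prod.map prod.snd (𝟙 B)) β *
            G.pull (prod.map prod.snd (𝟙 A)) α)) := by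
  have hp : IsPullback
      (prod.map prod.fst (𝟙 A) : ((F ⨯ D) ⨯ B) ⨯ A ⟶ (F ⨯ D) ⨯ A)
      (prod.map (prod.map prod.snd (𝟙 B)) (𝟙 A) : ((F ⨯ D) ⨯ B) ⨯ A ⟶ (D ⨯ B) ⨯ A)
      (prod.map prod.snd (𝟙 A)) (prod.map prod.fst (𝟙 A)) := by
    refine isPullback_of_exists_lift (by ext <;> simp) (fun T s t h => ?_)
      (fun T l l' h h' => ?_)
    · have h₁ : s ≫ prod.fst ≫ prod.snd = t ≫ prod.fst ≫ prod.fst := by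
        simpa using congr($h ≫ prod.fst)
      have h₂ : s ≫ prod.snd = t ≫ prod.snd := by simpa using congr($h ≫ prod.snd)
      exact ⟨prod.lift (prod.lift (s ≫ prod.fst) (t ≫ prod.fst ≫ prod.snd)) (s ≫ prod.snd),
        by ext <;> simp, by ext <;> simp [h₁, h₂]⟩
    · have h₁ : l ≫ prod.fst ≫ prod.fst = l' ≫ prod.fst ≫ prod.fst := by
        simpa using congr($h ≫ prod.fst)
      have h₂ : l ≫ prod.snd = l' ≫ prod.snd := by simpa using congr($h ≫ prod.snd)
      have h₃ : l ≫ prod.fst ≫ prod.snd = l' ≫ prod.fst ≫ prod.snd := by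
        simpa using congr($h' ≫ prod.fst ≫ prod.snd)
      apply Limits.prod.hom_ext
      · apply Limits.prod.hom_ext <;> simp [h₁, h₃]
      · exact h₂
  change G.push _ (G.pull _ γ * G.pull _ (G.push _ (G.pull _ β * G.pull _ α))) = _
  rw [← G.push_pull _ _ _ _ hp, ← push_pull_mul, push_push, (G.pull _).map_mul]
  simp only [pull_pull, prod.map_map, prod.map_fst, Category.comp_id, prod.map_snd]

theorem comp_comp_left {A B D F : C} (γ : G.E (F ⨯ D)) (β : G.E (D ⨯ B))
    (α : G.E (B ⨯ A)) :
    (G.comp (A := A) (B := B) (Cc := F) (G.comp (A := B) (B := D) (Cc := F) γ β) α :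
        G.E (F ⨯ A)) =
      G.push (prod.map (prod.fst ≫ prod.fst) (𝟙 A) : ((F ⨯ D) ⨯ B) ⨯ A ⟶ F ⨯ A)
        (G.pull (prod.fst ≫ prod.fst) γ *
          (G.pull (prod.fst ≫ prod.map prod.snd (𝟙 B)) β *
            G.pull (prod.map prod.snd (𝟙 A)) α)) := by
  have hp : IsPullback
      (prod.map (prod.map prod.fst (𝟙 B)) (𝟙 A) : ((F ⨯ D) ⨯ B) ⨯ A ⟶ (F ⨯ B) ⨯ A)
      prod.fst prod.fst (prod.map prod.fst (𝟙 B)) := by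
    refine isPullback_of_exists_lift (by ext <;> simp) (fun T s t h => ?_)
      (fun T l l' h h' => ?_)
    · exact ⟨prod.lift t (s ≫ prod.snd), by
        apply Limits.prod.hom_ext <;> simp [h], by simp⟩
    · exact Limits.prod.hom_ext h' (by simpa using congr($h ≫ prod.snd))
  change G.push _ (G.pull _ (G.push _ (G.pull _ γ * G.pull _ β)) * G.pull _ α) = _
  rw [← G.push_pull _ _ _ _ hp, ← push_mul_pull, push_push, (G.pull _).map_mul, mul_assoc]
  simp only [pull_pull, prod.map_map, prod.map_fst, prod.map_snd, Category.comp_id]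

theorem comp_Rmor {A B D : C} (β : G.E (D ⨯ B)) (f : A ⟶ B) :
    (G.comp (A := A) (B := B) (Cc := D) β (G.Rmor f) : G.E (D ⨯ A)) =
      G.pull (prod.map (𝟙 D) f) β := by
  have hp : IsPullback
      (prod.lift (prod.map (𝟙 D) f) prod.snd : D ⨯ A ⟶ (D ⨯ B) ⨯ A) prod.snd
      (prod.map prod.snd (𝟙 A)) (prod.lift f (𝟙 A)) := by
    refine isPullback_of_exists_lift (by ext <;> simp) (fun T s t h => ?_)
      (fun T l l' h h' => ?_)
    · have h₁ : s ≫ prod.fst ≫ prod.snd = t ≫ f := by simpa using congr($h ≫ prod.fst)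
      have h₂ : s ≫ prod.snd = t := by simpa using congr($h ≫ prod.snd)
      exact ⟨prod.lift (s ≫ prod.fst ≫ prod.fst) t, by ext <;> simp [h₁, h₂], by simp⟩
    · exact Limits.prod.hom_ext (by simpa using congr($h ≫ prod.fst ≫ prod.fst)) h'
  change G.push _ (G.pull _ β * G.pull _ (G.push _ 1)) = _
  have h := G.push_pull _ _ _ _ hp 1
  rw [← h, map_one, ← push_pull_mul, push_push, mul_one, pull_pull, prod.lift_fst]
  have h' : prod.lift (prod.map (𝟙 D) f) prod.snd ≫ prod.map prod.fst (𝟙 A) = 𝟙 (D ⨯ A) := by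
    ext <;> simp
  rw [h', push_id_apply]

theorem Rmor_comp_eq_pull {A B D : C} (f : A ⟶ B) (g : B ⟶ D) :
    (G.Rmor (f ≫ g) : G.E (D ⨯ A)) = G.pull (prod.map (𝟙 D) f) (G.Rmor g : G.E (D ⨯ B)) := by
  have hp : IsPullback (prod.lift (f ≫ g) (𝟙 A)) f (prod.map (𝟙 D) f)
      (prod.lift g (𝟙 B)) := by
    refine isPullback_of_exists_lift (by ext <;> simp) (fun T s t h => ?_)
      (fun T l l' h _ => by simpa using congr($h ≫ prod.snd))
    have h₁ : s ≫ prod.fst = t ≫ g := by simpa using congr($h ≫ prod.fst)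
    have h₂ : s ≫ prod.snd ≫ f = t := by simpa using congr($h ≫ prod.snd)
    refine ⟨s ≫ prod.snd, ?_, by simpa using h₂⟩
    apply Limits.prod.hom_ext
    · simp [h₁, ← h₂]
    · simp
  have h := G.push_pull _ _ _ _ hp 1
  rw [map_one] at h
  exact h

theorem star_star {A B : C} (α : G.Hom A B) : G.star (G.star α) = α := by
  refine (G.pull_pull (prod.braiding B A).hom (prod.braiding A B).hom α).trans ?_
  rw [prod.symmetry]
  exact G.pull_id_apply α

theorem star_Rmor {A B : C} (f : A ⟶ B) : G.star (G.Rmor f) = G.Imor f := by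
  change G.pull _ (G.push _ 1) = G.push _ 1
  rw [pull_eq_push_inv, push_push]
  congr 2
  ext <;> simp

theorem Rmor_id (A : C) : G.Rmor (𝟙 A) = G.ident A := rfl

theorem star_ident (A : C) : G.star (G.ident A) = G.ident A :=
  G.star_Rmor (𝟙 A)

theorem star_comp {A B D : C} (β : G.E (D ⨯ B)) (α : G.E (B ⨯ A)) :
    G.star (G.comp (A := A) (B := B) (Cc := D) β α) =
      G.comp (G.star (A := A) (B := B) α) (G.star (A := B) (B := D) β) := by
  let e : (D ⨯ B) ⨯ A ≅ (A ⨯ B) ⨯ D :=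
    { hom := prod.lift (prod.lift prod.snd (prod.fst ≫ prod.snd)) (prod.fst ≫ prod.fst)
      inv := prod.lift (prod.lift prod.snd (prod.fst ≫ prod.snd)) (prod.fst ≫ prod.fst)
      hom_inv_id := by ext <;> simp
      inv_hom_id := by ext <;> simp }
  refine Eq.trans ?_
    (G.comp_eq_push_of_iso e (G.star (A := A) (B := B) α) (G.star (A := B) (B := D) β)).symm
  change G.pull _ (G.push _ (G.pull _ β * G.pull _ α)) =
    G.push _ (G.pull _ (G.pull _ α) * G.pull _ (G.pull _ β))
  have h : e.hom ≫ prod.map prod.fst (𝟙 D) =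
      prod.map prod.fst (𝟙 A) ≫ (prod.braiding A D).inv := by
    ext <;> simp [e]
  have hα : (e.hom ≫ prod.fst) ≫ (prod.braiding A B).hom = prod.map prod.snd (𝟙 A) := by
    ext <;> simp [e]
  have hβ : (e.hom ≫ prod.map prod.snd (𝟙 D)) ≫ (prod.braiding B D).hom = prod.fst := by
    ext <;> simp [e]
  rw [pull_eq_push_inv, push_push, pull_pull, pull_pull, mul_comm, h, hα, hβ]

theorem comp_ident {A B : C} (α : G.Hom A B) : G.comp α (G.ident A) = α := by
  refine (G.comp_Rmor (D := B) α (𝟙 A)).trans ?_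
  rw [prod.map_id_id]
  exact G.pull_id_apply α

theorem ident_comp {A B : C} (α : G.Hom A B) : G.comp (G.ident B) α = α := by
  have h : G.star (G.comp (G.ident B) α) = G.star α := by
    refine (G.star_comp (G.ident B) α).trans ?_
    exact (congrArg _ (G.star_ident B)).trans (G.comp_ident (G.star α))
  rw [← G.star_star (G.comp (G.ident B) α), h, star_star]

theorem comp_add {A B D : C} (β : G.E (D ⨯ B)) (α α' : G.E (B ⨯ A)) :
    (G.comp (A := A) (B := B) (Cc := D) β (α + α' : G.E (B ⨯ A)) : G.E (D ⨯ A)) =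
      (G.comp (A := A) (B := B) (Cc := D) β α : G.E (D ⨯ A)) +
        (G.comp (A := A) (B := B) (Cc := D) β α' : G.E (D ⨯ A)) := by
  change G.push _ (G.pull _ β * G.pull _ (α + α')) = _
  rw [map_add, mul_add, map_add]
  rfl

theorem add_comp {A B D : C} (β β' : G.E (D ⨯ B)) (α : G.E (B ⨯ A)) :
    (G.comp (A := A) (B := B) (Cc := D) (β + β' : G.E (D ⨯ B)) α : G.E (D ⨯ A)) =
      (G.comp (A := A) (B := B) (Cc := D) β α : G.E (D ⨯ A)) +
        (G.comp (A := A) (B := B) (Cc := D) β' α : G.E (D ⨯ A)) := by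
  change G.push _ (G.pull _ (β + β') * G.pull _ α) = _
  rw [map_add, add_mul, map_add]
  rfl

end GysinFunctor

open GysinFunctor in
/-- The data of the category of correspondences `C_E` forms a category enriched over
abelian groups, `R` is a functor, `star` is an anti-automorphism, and `If = (Rf)^*`. -/
theorem gysinFunctor_correspondenceCategory
    {C : Type u} [Category.{v} C] [HasFiniteLimits C]
    [HasFiniteCoproducts C] [FinitaryExtensive C] (G : GysinFunctor C) :
    -- composition is bilinear
    (∀ (A B Cc : C) (β β' : G.Hom B Cc) (α α' : G.Hom A B),
      G.comp (β + β') α = G.comp β α + G.comp β' α ∧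
      G.comp β (α + α') = G.comp β α + G.comp β α') ∧
    -- composition is associative
    (∀ (A B Cc D' : C) (γ : G.Hom Cc D') (β : G.Hom B Cc) (α : G.Hom A B),
      G.comp γ (G.comp β α) = G.comp (G.comp γ β) α) ∧
    -- `i_A` is a two-sided identity
    (∀ (A B : C) (α : G.Hom A B), G.comp (G.ident B) α = α ∧ G.comp α (G.ident A) = α) ∧
    -- (i) `R` is a functor `C → C_E`
    (∀ A : C, G.Rmor (𝟙 A) = G.ident A) ∧
    (∀ (A B Cc : C) (f : A ⟶ B) (g : B ⟶ Cc),
      G.Rmor (f ≫ g) = G.comp (G.Rmor g) (G.Rmor f)) ∧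
    -- (ii) `star` is an anti-automorphism which is the identity on objects
    (∀ A : C, G.star (G.ident A) = G.ident A) ∧
    (∀ (A B Cc : C) (β : G.Hom B Cc) (α : G.Hom A B),
      G.star (G.comp β α) = G.comp (G.star α) (G.star β)) ∧
    (∀ (A B : C), Function.Bijective (fun α : G.Hom A B => G.star α)) ∧
    -- (iii) `If = (Rf)^*`
    (∀ (A B : C) (f : A ⟶ B), G.Imor f = G.star (G.Rmor f)) := by
  exact ⟨fun _ _ _ β β' α α' => ⟨G.add_comp β β' α, G.comp_add β α α'⟩,
    fun _ _ _ _ γ β α => (G.comp_comp_right γ β α).trans (G.comp_comp_left γ β α).symm,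
    fun _ _ α => ⟨G.ident_comp α, G.comp_ident α⟩,
    G.Rmor_id,
    fun _ _ _ f g => (G.Rmor_comp_eq_pull f g).trans (G.comp_Rmor (G.Rmor g) f).symm,
    G.star_ident,
    fun _ _ _ β α => G.star_comp β α,
    fun _ _ => Function.bijective_iff_has_inverse.mpr
      ⟨fun α => G.star α, G.star_star, G.star_star⟩,
    fun _ _ f => (G.star_Rmor f).symm⟩
end

section
/- Let E be a Gysin functor on a finitary lextensive category C, and let f : A → X and g : B → X be morphisms in C. Then (f ×_X g)_!(1) = f_!(1) · g_!(1) in E(X), where f ×_X g : A ×_X B → X is the canonical map from the pullback of f and g. -/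
open CategoryTheory CategoryTheory.Limits

universe v u

/-- The pullback of `f` and `g` is the pullback of `f × g` along the diagonal. -/
theorem isPullback_diag_prodMap {C : Type u} [Category.{v} C] [HasFiniteLimits C]
    {A B X : C} (f : A ⟶ X) (g : B ⟶ X) :
    IsPullback (pullback.fst f g ≫ f) (prod.lift (pullback.fst f g) (pullback.snd f g))
      (diag X) (prod.map f g) := by
  have fst_eq {W : C} {a : W ⟶ X} {b : W ⟶ A ⨯ B} (h : a ≫ diag X = b ≫ prod.map f g) :
      a = (b ≫ prod.fst) ≫ f := by
    have hd : diag X ≫ prod.fst = 𝟙 X := prod.lift_fst _ _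
    have h' := h =≫ prod.fst
    rwa [Category.assoc, Category.assoc, prod.map_fst, hd, Category.comp_id,
      ← Category.assoc] at h'
  have snd_eq {W : C} {a : W ⟶ X} {b : W ⟶ A ⨯ B} (h : a ≫ diag X = b ≫ prod.map f g) :
      a = (b ≫ prod.snd) ≫ g := by
    have hd : diag X ≫ prod.snd = 𝟙 X := prod.lift_snd _ _
    have h' := h =≫ prod.snd
    rwa [Category.assoc, Category.assoc, prod.map_snd, hd, Category.comp_id,
      ← Category.assoc] at h'
  refine ⟨⟨by ext <;> simp [pullback.condition]⟩, ⟨PullbackCone.IsLimit.mk _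
    (fun s => pullback.lift (s.snd ≫ prod.fst) (s.snd ≫ prod.snd)
      ((fst_eq s.condition).symm.trans (snd_eq s.condition))) (fun s => ?_) (fun s => ?_) (fun s m _ hm => ?_)⟩⟩
  · rw [pullback.lift_fst_assoc, ← fst_eq s.condition]
  · apply Limits.prod.hom_ext
    · rw [Category.assoc, prod.lift_fst, pullback.lift_fst]
    · rw [Category.assoc, prod.lift_snd, pullback.lift_snd]
  · apply pullback.hom_ext
    · rw [pullback.lift_fst, ← hm, Category.assoc, prod.lift_fst]
    · rw [pullback.lift_snd, ← hm, Category.assoc, prod.lift_snd]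

/-- `(f ×_X g)_!(1) = f_!(1) · g_!(1)`. -/
theorem gysinFunctor_push_pullback_one
    {C : Type u} [Category.{v} C] [HasFiniteLimits C]
    [HasFiniteCoproducts C] [FinitaryExtensive C] (G : GysinFunctor C)
    {A B X : C} (f : A ⟶ X) (g : B ⟶ X) :
    G.push ((pullback.fst f g ≫ f : pullback f g ⟶ X)) (1 : G.E (pullback f g))
      = G.push f (1 : G.E A) * G.push g (1 : G.E B) := by
  have h := G.push_pull _ _ _ _ (isPullback_diag_prodMap f g) 1
  have hp := G.push_product f g 1 1
  simp only [map_one, mul_one] at h hp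
  rw [h, hp, map_mul, ← RingHom.comp_apply, ← RingHom.comp_apply, ← G.pull_comp,
    ← G.pull_comp, diag, prod.lift_fst, prod.lift_snd, G.pull_id]
  rfl
end

section
/- Let E be a Gysin functor on a finitary lextensive category C, and let f : A → B and g : X → Y be morphisms in C. Then in the category of correspondences C_E, with the tensor product of morphisms defined by u ⊗ v := (t)^*(u ⊗_E v) for u ∈ C_E(X, X') = E(X' × X), v ∈ C_E(Y, Y') = E(Y' × Y), where u ⊗_E v ∈ E(X' × X × Y' × Y) is the external product and t : X' × Y' × X × Y → X' × X × Y' × Y is the evident permutation isomorphism, one has R(f × g) = Rf ⊗ Rg and I(f × g) = If ⊗ Ig. -/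
open CategoryTheory CategoryTheory.Limits

universe v u

namespace GysinFunctor

variable {C : Type u} [Category.{v} C] [HasFiniteLimits C]
  [HasFiniteCoproducts C] [FinitaryExtensive C]

/-- The evident permutation isomorphism `(X' × Y') × (X × Y) ⟶ (X' × X) × (Y' × Y)`. -/
noncomputable def permute (X' Y' X Y : C) :
    (X' ⨯ Y') ⨯ (X ⨯ Y) ⟶ (X' ⨯ X) ⨯ (Y' ⨯ Y) :=
  prod.lift
    (prod.lift (prod.fst ≫ prod.fst) (prod.snd ≫ prod.fst))
    (prod.lift (prod.fst ≫ prod.snd) (prod.snd ≫ prod.snd))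

variable (G : GysinFunctor C)

/-- The tensor product of morphisms in the category of correspondences:
`u ⊗ v := t^*(u ⊗_E v)` where `u ⊗_E v` is the external product. -/
noncomputable def tensorHom {X X' Y Y' : C} (u : G.Hom X X') (v : G.Hom Y Y') :
    G.Hom (X ⨯ Y) (X' ⨯ Y') :=
  G.pull (permute X' Y' X Y)
    (G.pull (prod.fst : (X' ⨯ X) ⨯ (Y' ⨯ Y) ⟶ X' ⨯ X) u *
      G.pull (prod.snd : (X' ⨯ X) ⨯ (Y' ⨯ Y) ⟶ Y' ⨯ Y) v)

end GysinFunctor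

namespace GysinFunctor

variable {C : Type u} [Category.{v} C] [HasFiniteLimits C]

lemma permute_permute (X' Y' X Y : C) :
    permute X' Y' X Y ≫ permute X' X Y' Y = 𝟙 _ := by
  unfold permute
  ext <;> simp [prod.lift_fst, prod.lift_snd]

instance isIso_permute (X' Y' X Y : C) : IsIso (permute X' Y' X Y) :=
  ⟨permute X' X Y' Y, permute_permute X' Y' X Y, permute_permute X' X Y' Y⟩

lemma lift_map_map_permute {P Q X' Y' X Y : C} (a : P ⟶ X') (b : P ⟶ X)
    (c : Q ⟶ Y') (d : Q ⟶ Y) :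
    prod.lift (prod.map a c) (prod.map b d) ≫ permute X' Y' X Y =
      prod.map (prod.lift a b) (prod.lift c d) := by
  unfold permute
  ext <;> simp [prod.lift_fst, prod.lift_snd]

variable [HasFiniteCoproducts C] [FinitaryExtensive C] (G : GysinFunctor C)

/-- The tensor product of the correspondences given by two spans `X' ← P → X` and
`Y' ← Q → Y` is the correspondence given by the product span. -/
lemma tensorHom_push_lift_one {P Q X' Y' X Y : C} (a : P ⟶ X') (b : P ⟶ X)
    (c : Q ⟶ Y') (d : Q ⟶ Y) :
    G.tensorHom (G.push (prod.lift a b) 1 : G.E (X' ⨯ X))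
        (G.push (prod.lift c d) 1 : G.E (Y' ⨯ Y)) =
      G.push (prod.lift (prod.map a c) (prod.map b d)) 1 := by
  have hsq : IsPullback (prod.lift (prod.map a c) (prod.map b d)) (𝟙 (P ⨯ Q))
      (permute X' Y' X Y) (prod.map (prod.lift a b) (prod.lift c d)) :=
    IsPullback.of_vert_isIso ⟨by rw [lift_map_map_permute, Category.id_comp]⟩
  have hpull := G.push_pull _ _ _ _ hsq 1
  have hprod := G.push_product (prod.lift a b) (prod.lift c d) 1 1
  rw [map_one, map_one, mul_one] at hprod
  rw [map_one, hprod] at hpull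
  exact hpull.symm

end GysinFunctor

open GysinFunctor in
/-- `R(f × g) = Rf ⊗ Rg` and `I(f × g) = If ⊗ Ig` in the category of correspondences. -/
theorem gysinFunctor_R_I_tensor
    {C : Type u} [Category.{v} C] [HasFiniteLimits C]
    [HasFiniteCoproducts C] [FinitaryExtensive C] (G : GysinFunctor C)
    {A B X Y : C} (f : A ⟶ B) (g : X ⟶ Y) :
    G.Rmor (prod.map f g) = G.tensorHom (G.Rmor f) (G.Rmor g) ∧
    G.Imor (prod.map f g) = G.tensorHom (G.Imor f) (G.Imor g) := by
  constructor
  · have h := G.tensorHom_push_lift_one f (𝟙 A) g (𝟙 X)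
    rw [prod.map_id_id] at h
    exact h.symm
  · have h := G.tensorHom_push_lift_one (𝟙 A) f (𝟙 X) g
    rw [prod.map_id_id] at h
    exact h.symm
end

section
/- Let C be a Galoisien category and let X and Y be atomic objects of C with Y Galois. Then the hom-set C(X, Y) is either empty or a torsor under Aut(Y): for any f ∈ C(X, Y), the map Aut(Y) → C(X, Y) given by σ ↦ σ ∘ f is a bijection. -/
open CategoryTheory CategoryTheory.Limits

universe v u

/-- An object is atomic if it is not initial and is not a coproduct of two
non-initial objects. -/
def AtomicObj {C : Type u} [Category.{v} C] [HasFiniteLimits C]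
    [HasFiniteCoproducts C] [FinitaryExtensive C] (X : C) : Prop :=
  ¬ Nonempty (IsInitial X) ∧
  ∀ A B : C, Nonempty (X ≅ A ⨿ B) → Nonempty (IsInitial A) ∨ Nonempty (IsInitial B)

/-- A Galoisien category: a finitary lextensive category where maps out of atomic
objects into coproducts decompose, automorphism groups of atomic objects are finite,
and there are no maps from non-initial objects to the initial object. -/
structure Galoisien (C : Type u) [Category.{v} C] [HasFiniteLimits C]
    [HasFiniteCoproducts C] [FinitaryExtensive C] : Prop where
  hom_coprod : ∀ X : C, AtomicObj X → ∀ Y Z : C, Function.Bijective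
    (Sum.elim (fun f : X ⟶ Y => f ≫ (coprod.inl : Y ⟶ Y ⨿ Z))
      (fun g : X ⟶ Z => g ≫ (coprod.inr : Z ⟶ Y ⨿ Z)))
  aut_finite : ∀ X : C, AtomicObj X → Finite (Aut X)
  no_map_to_initial : ∀ X : C, ¬ Nonempty (IsInitial X) → IsEmpty (X ⟶ (⊥_ C))

/-- An object `Y` is Galois if the canonical map `⊔_{σ ∈ Aut(Y)} Y → Y × Y`,
whose `σ`-component is `(id_Y, σ)`, is an isomorphism (i.e. these components
exhibit `Y × Y` as the coproduct of `Aut(Y)` copies of `Y`). -/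
def GaloisObj {C : Type u} [Category.{v} C] [HasFiniteLimits C]
    [HasFiniteCoproducts C] [FinitaryExtensive C] (Y : C) : Prop :=
  Nonempty (IsColimit (Cofan.mk (f := fun _ : Aut Y => Y) (Y ⨯ Y)
    (fun σ : Aut Y => prod.lift (𝟙 Y) σ.hom)))

/-- A map from an atomic object to a finite coproduct factors through an inclusion. -/
theorem Galoisien.exists_comp_sigma_ι {C : Type u} [Category.{v} C] [HasFiniteLimits C]
    [HasFiniteCoproducts C] [FinitaryExtensive C] (hC : Galoisien C)
    {X : C} (hX : AtomicObj X) {ι : Type v} [Finite ι] (F : ι → C) (f : X ⟶ ∐ F) :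
    ∃ (i : ι) (g : X ⟶ F i), g ≫ Sigma.ι F i = f := by
  refine Finite.induction_empty_option
    (P := fun ι => ∀ [Finite ι] (F : ι → C) (f : X ⟶ ∐ F),
      ∃ (i : ι) (g : X ⟶ F i), g ≫ Sigma.ι F i = f) ?_ ?_ ?_ ι F f
  · intro α β e ih _ F f
    have : Finite α := Finite.of_equiv β e.symm
    obtain ⟨i, g, hg⟩ := ih (F ∘ e) (f ≫ (Sigma.reindex e F).inv)
    refine ⟨e i, g, ?_⟩
    rw [← cancel_mono (Sigma.reindex e F).inv, ← hg, Category.assoc, Sigma.ι_reindex_inv]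
  · intro _ F f
    exact ((hC.no_map_to_initial X hX.1).false (f ≫ Sigma.desc fun i => i.elim)).elim
  · intro α _ ih _ F f
    let s : ∐ F ⟶ (∐ fun a => F (some a)) ⨿ F none := Sigma.desc fun
      | none => coprod.inr
      | some a => Sigma.ι (fun a => F (some a)) a ≫ coprod.inl
    let p : (∐ fun a => F (some a)) ⨿ F none ⟶ ∐ F :=
      coprod.desc (Sigma.desc fun a => Sigma.ι F (some a)) (Sigma.ι F none)
    have hsp : s ≫ p = 𝟙 _ := by
      refine Sigma.hom_ext _ _ fun i => ?_
      cases i <;> simp [s, p, coprod.inl_desc, coprod.inr_desc]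
    have hf : (f ≫ s) ≫ p = f := by rw [Category.assoc, hsp, Category.comp_id]
    obtain ⟨g | g, hg⟩ := (hC.hom_coprod X hX _ _).2 (f ≫ s)
    · obtain ⟨a, k, rfl⟩ := ih _ g
      refine ⟨some a, k, ?_⟩
      rw [← hf, ← hg]
      simp [p, coprod.inl_desc]
    · refine ⟨none, g, ?_⟩
      rw [← hf, ← hg]
      simp [p, coprod.inr_desc]

/-- In a Galoisien category, for atomic `X`, `Y` with `Y` Galois, the hom-set
`C(X, Y)` is either empty or a torsor under `Aut(Y)`: for any `f : X ⟶ Y`,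
`σ ↦ σ ∘ f` is a bijection `Aut(Y) → C(X, Y)`. -/
theorem galoisien_hom_torsor {C : Type u} [Category.{v} C] [HasFiniteLimits C]
    [HasFiniteCoproducts C] [FinitaryExtensive C] (hC : Galoisien C)
    {X Y : C} (hX : AtomicObj X) (hY : AtomicObj Y) (hGal : GaloisObj Y)
    (f : X ⟶ Y) :
    Function.Bijective (fun σ : Aut Y => f ≫ σ.hom) := by
  have := hC.aut_finite Y hY
  obtain ⟨hc⟩ := hGal
  constructor
  · intro σ τ h
    by_contra hne
    have hpb := FinitaryExtensive.isPullback_initial_to hc ⟨σ⟩ ⟨τ⟩ (ne_of_apply_ne Discrete.as hne)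
    have hw : f ≫ prod.lift (𝟙 Y) σ.hom = f ≫ prod.lift (𝟙 Y) τ.hom := by
      simp only [prod.comp_lift]
      exact congrArg (prod.lift (f ≫ 𝟙 Y)) h
    exact (hC.no_map_to_initial X hX.1).false (hpb.lift f f hw)
  · intro g
    let d : Y ⨯ Y ≅ ∐ fun _ : Aut Y => Y :=
      hc.coconePointUniqueUpToIso (coproductIsCoproduct fun _ : Aut Y => Y)
    obtain ⟨σ, k, hk⟩ := hC.exists_comp_sigma_ι hX _ (prod.lift f g ≫ d.hom)
    have hσ : Sigma.ι (fun _ : Aut Y => Y) σ ≫ d.inv = prod.lift (𝟙 Y) σ.hom :=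
      hc.comp_coconePointUniqueUpToIso_inv (coproductIsCoproduct fun _ : Aut Y => Y) ⟨σ⟩
    have hlift : k ≫ prod.lift (𝟙 Y) σ.hom = prod.lift f g := by
      rw [← hσ, ← Category.assoc, hk, Category.assoc, d.hom_inv_id, Category.comp_id]
    have h₁ : k = f := by
      simpa [prod.lift_fst] using congrArg (· ≫ prod.fst) hlift
    have h₂ : k ≫ σ.hom = g := by
      simpa [prod.lift_snd] using congrArg (· ≫ prod.snd) hlift
    exact ⟨σ, h₁ ▸ h₂⟩
end

section
/- Let R be a Noetherian commutative ring and S a commutative R-algebra. Then R → S is both sheer and separable if and only if R → S is finite étale, i.e., S is a finitely generated R-module and S is an étale R-algebra (flat and unramified, equivalently formally étale and of finite presentation). -/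
open scoped TensorProduct

universe u

/-- An algebra essentially of finite type is separable if and only if it is formally unramified. -/
theorem Algebra.FormallyUnramified.iff_projective_tensorProduct
    {R S : Type*} [CommRing R] [CommRing S] [Algebra R S] [Algebra.EssFiniteType R S] :
    Algebra.FormallyUnramified R S ↔
      (letI : Module (S ⊗[R] S) S :=
        Module.compHom S (Algebra.TensorProduct.lmul' (S := S) R).toRingHom
       Module.Projective (S ⊗[R] S) S) := by
  let _ : Module (S ⊗[R] S) S :=
    Module.compHom S (Algebra.TensorProduct.lmul' (S := S) R).toRingHom
  have smul_def (a : S ⊗[R] S) (s : S) : a • s = Algebra.TensorProduct.lmul' R a * s := rfl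
  let mul : S ⊗[R] S →ₗ[S ⊗[R] S] S := LinearMap.toSpanSingleton (S ⊗[R] S) S 1
  have mul_apply (a : S ⊗[R] S) : mul a = Algebra.TensorProduct.lmul' R a := by
    simp [mul, smul_def]
  rw [Algebra.FormallyUnramified.iff_exists_tensorProduct]
  constructor
  · rintro ⟨t, ht, ht₁⟩
    have key (a : S ⊗[R] S) :
        ((1 : S) ⊗ₜ[R] Algebra.TensorProduct.lmul' R a) * t = a * t := by
      induction a using TensorProduct.induction_on with
      | zero => simp
      | tmul x y =>
        have h := ht x
        rw [sub_mul, sub_eq_zero] at h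
        have hxy : (1 : S) ⊗ₜ[R] (x * y) = (1 ⊗ₜ y) * (1 ⊗ₜ x) := by simp [mul_comm]
        have hxy' : x ⊗ₜ[R] y = (1 ⊗ₜ y) * (x ⊗ₜ 1) := by simp
        rw [Algebra.TensorProduct.lmul'_apply_tmul, hxy, hxy', mul_assoc, mul_assoc, h]
      | add x y hx hy => rw [map_add, TensorProduct.tmul_add, add_mul, hx, hy, add_mul]
    let sec : S →ₗ[S ⊗[R] S] S ⊗[R] S :=
      { toFun s := (1 ⊗ₜ[R] s) * t
        map_add' x y := by rw [TensorProduct.tmul_add, add_mul]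
        map_smul' a s := by
          have h : (1 : S) ⊗ₜ[R] (Algebra.TensorProduct.lmul' R a * s) =
              (1 ⊗ₜ s) * (1 ⊗ₜ Algebra.TensorProduct.lmul' R a) := by simp [mul_comm]
          rw [smul_def, h, mul_assoc, key, RingHom.id_apply, smul_eq_mul, mul_left_comm] }
    refine Module.Projective.of_split sec mul (LinearMap.ext fun s ↦ ?_)
    change mul ((1 ⊗ₜ[R] s) * t) = s
    rw [mul_apply, map_mul, ht₁, Algebra.TensorProduct.lmul'_apply_tmul, one_mul, mul_one]
  · intro h
    have hmul : Function.Surjective mul := fun s ↦ ⟨1 ⊗ₜ s, by simp [mul_apply]⟩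
    obtain ⟨sec, hsec⟩ := Module.projective_lifting_property mul LinearMap.id hmul
    refine ⟨sec 1, fun s ↦ ?_, ?_⟩
    · rw [← smul_eq_mul, ← map_smul, smul_def]
      simp
    · rw [← mul_apply]
      exact LinearMap.congr_fun hsec 1

/-- For a Noetherian commutative ring `R` and a commutative `R`-algebra `S`,
the map `R → S` is both sheer (i.e. `S` is a finitely generated projective
`R`-module) and separable (i.e. `S` is projective as an `S ⊗[R] S`-module,
via the multiplication map) if and only if `R → S` is finite étale. -/
theorem sheer_separable_iff_finite_etale
    (R S : Type u) [CommRing R] [CommRing S] [Algebra R S] [IsNoetherianRing R] :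
    (Module.Finite R S ∧ Module.Projective R S ∧
      (letI : Module (S ⊗[R] S) S :=
        Module.compHom S (Algebra.TensorProduct.lmul' (S := S) R).toRingHom
       Module.Projective (S ⊗[R] S) S))
    ↔ (Module.Finite R S ∧ Algebra.Etale R S) := by
  refine and_congr_right fun _ ↦ ?_
  rw [← Algebra.FormallyUnramified.iff_projective_tensorProduct]
  constructor
  · rintro ⟨_, _⟩
    have : Algebra.FinitePresentation R S :=
      Algebra.FinitePresentation.of_finiteType.mp inferInstance
    exact Algebra.Etale.of_formallyUnramified_of_flat
  · intro _
    have : Module.FinitePresentation R S := Module.finitePresentation_of_finite R S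
    exact ⟨Module.Flat.projective_of_finitePresentation, inferInstance⟩
end
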